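/- arXiv:1305.7413 — 3 statements merged into one kernel-verified Lean document; each statement's English description precedes it below -/
import Mathlib

section
/- The left reduction 𝒟 of a Dyck automaton is weak-deterministic: for the initial state I = (∅,Q) of 𝒟 and every finite word u over A, there is at most one admissible path of 𝒟 labeled by u starting at I. -/
namespace SD

/-- The three kinds of letters of a pushdown alphabet. -/
inductive LetterKind : Type
  | call
  | ret
  | intern
  deriving DecidableEq

/-- A pushdown alphabet structure on `A`: a partition of the letters into
call letters, return letters and internal letters. -/
structure PushdownAlphabet (A : Type*) where
  kind : A → LetterKind

/-- Number of call letters of a word. -/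
def callCount {A : Type*} (P : PushdownAlphabet A) (u : List A) : ℕ :=
  u.countP (fun a => decide (P.kind a = LetterKind.call))

/-- Number of return letters of a word. -/
def retCount {A : Type*} (P : PushdownAlphabet A) (u : List A) : ℕ :=
  u.countP (fun a => decide (P.kind a = LetterKind.ret))

/-- A word is matched-return if every prefix has at least as many call letters
as return letters. -/
def MatchedReturn {A : Type*} (P : PushdownAlphabet A) (u : List A) : Prop :=
  ∀ v w : List A, u = v ++ w → retCount P v ≤ callCount P v

/-- A word is matched-call if every suffix has at least as many return letters
as call letters. -/
def MatchedCall {A : Type*} (P : PushdownAlphabet A) (u : List A) : Prop :=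
  ∀ v w : List A, u = v ++ w → callCount P w ≤ retCount P w

/-- A Dyck word is a word which is both matched-return and matched-call. -/
def IsDyck {A : Type*} (P : PushdownAlphabet A) (u : List A) : Prop :=
  MatchedReturn P u ∧ MatchedCall P u

/-- The factor of length `n` of a bi-infinite sequence starting at position `i`. -/
def factorAt {A : Type*} (x : ℤ → A) (i : ℤ) (n : ℕ) : List A :=
  (List.range n).map (fun k => x (i + (k : ℤ)))

/-- `w` is a (finite) factor of the bi-infinite sequence `x`. -/
def IsFactorOf {A : Type*} (w : List A) (x : ℤ → A) : Prop :=
  ∃ i : ℤ, w = factorAt x i w.length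

/-- A Dyck automaton over alphabet `A` with states `Q`: a labeled graph together
with a set of matched pairs of edges. -/
structure DyckAutomaton (A : Type*) (Q : Type*) where
  edges : Set (Q × A × Q)
  matched : Set ((Q × A × Q) × (Q × A × Q))

/-- Well-formedness of a Dyck automaton: matched pairs consist of edges of the
automaton, a call edge followed by a return edge. -/
def DyckAutomaton.WellFormed {A Q : Type*} (P : PushdownAlphabet A)
    (𝒜 : DyckAutomaton A Q) : Prop :=
  ∀ e f : Q × A × Q, (e, f) ∈ 𝒜.matched →
    e ∈ 𝒜.edges ∧ f ∈ 𝒜.edges ∧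
    P.kind e.2.1 = LetterKind.call ∧ P.kind f.2.1 = LetterKind.ret

/-- The label of a finite path. -/
def pathLabel {A Q : Type*} (π : List (Q × A × Q)) : List A :=
  π.map (fun e => e.2.1)

/-- A finite path of the underlying graph: a sequence of consecutive edges. -/
def IsPath {A Q : Type*} (𝒜 : DyckAutomaton A Q) (π : List (Q × A × Q)) : Prop :=
  (∀ e ∈ π, e ∈ 𝒜.edges) ∧ π.Chain' (fun e f => e.2.2 = f.1)

/-- A finite path is admissible if for any factor `e · π₁ · f` of it with `e` a call
edge, `f` a return edge and the label of `π₁` a Dyck word, `(e,f)` is a matched pair. -/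
def IsAdmissible {A Q : Type*} (P : PushdownAlphabet A) (𝒜 : DyckAutomaton A Q)
    (π : List (Q × A × Q)) : Prop :=
  IsPath 𝒜 π ∧
  ∀ (π₀ : List (Q × A × Q)) (e : Q × A × Q) (π₁ : List (Q × A × Q)) (f : Q × A × Q)
    (π₂ : List (Q × A × Q)), π = π₀ ++ e :: π₁ ++ f :: π₂ →
    P.kind e.2.1 = LetterKind.call → P.kind f.2.1 = LetterKind.ret →
    IsDyck P (pathLabel π₁) → (e, f) ∈ 𝒜.matched

/-- The finite factor of a bi-infinite path starting at index `i`, of length `n`. -/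
def pathSeg {A Q : Type*} (π : ℤ → Q × A × Q) (i : ℤ) (n : ℕ) : List (Q × A × Q) :=
  (List.range n).map (fun k => π (i + (k : ℤ)))

/-- A bi-infinite path is admissible if it is a bi-infinite path of the graph all of
whose finite factors are admissible. -/
def BiAdmissible {A Q : Type*} (P : PushdownAlphabet A) (𝒜 : DyckAutomaton A Q)
    (π : ℤ → Q × A × Q) : Prop :=
  (∀ i : ℤ, π i ∈ 𝒜.edges) ∧ (∀ i : ℤ, (π i).2.2 = (π (i + 1)).1) ∧
  ∀ (i : ℤ) (n : ℕ), IsAdmissible P 𝒜 (pathSeg π i n)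

/-- The sofic-Dyck shift presented by a Dyck automaton: the set of labels of
bi-infinite admissible paths. -/
def presents {A Q : Type*} (P : PushdownAlphabet A) (𝒜 : DyckAutomaton A Q) :
    Set (ℤ → A) :=
  { x | ∃ π : ℤ → Q × A × Q, BiAdmissible P 𝒜 π ∧ ∀ i : ℤ, (π i).2.1 = x i }

/-- A sofic-Dyck shift over `A`: a set presented by some (finite, well-formed)
Dyck automaton. -/
def IsSoficDyck {A : Type*} (P : PushdownAlphabet A) (X : Set (ℤ → A)) : Prop :=
  ∃ (N : ℕ) (𝒜 : DyckAutomaton A (Fin N)), 𝒜.WellFormed P ∧ X = presents P 𝒜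

/-- A finite path goes from `p` to `q` (an empty path goes from `p` to `p`). -/
def GoesFromTo {A Q : Type*} (π : List (Q × A × Q)) (p q : Q) : Prop :=
  (∀ e ∈ π.head?, e.1 = p) ∧ (∀ e ∈ π.getLast?, e.2.2 = q) ∧ (π = [] → p = q)

/-- A finite path starts at state `p`. -/
def StartsAt {A Q : Type*} (π : List (Q × A × Q)) (p : Q) : Prop :=
  ∀ e ∈ π.head?, e.1 = p

/-- States of the left reduction: pairs of a summary and a set of states. -/
abbrev LRState (Q : Type*) := Set (Q × Q) × Set Q

/-- The initial state `I = (∅, Q)` of the left reduction. -/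
def lrInit (Q : Type*) : LRState Q := (∅, Set.univ)

/-- Successors of a set of states by a letter. -/
def lrSucc {A Q : Type*} (𝒜 : DyckAutomaton A Q) (R : Set Q) (a : A) : Set Q :=
  { q | ∃ p ∈ R, (p, a, q) ∈ 𝒜.edges }

/-- Update of a summary by an internal letter. -/
def lrSuccS {A Q : Type*} (𝒜 : DyckAutomaton A Q) (S : Set (Q × Q)) (a : A) :
    Set (Q × Q) :=
  { pq | ∃ r, (pq.1, r) ∈ S ∧ (r, a, pq.2) ∈ 𝒜.edges }

/-- The diagonal of a set of states. -/
def lrDiag {Q : Type*} (R : Set Q) : Set (Q × Q) :=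
  { pq | pq.1 = pq.2 ∧ pq.1 ∈ R }

/-- Internal edges of the left reduction. -/
def lrInternEdge {A Q : Type*} (P : PushdownAlphabet A) (𝒜 : DyckAutomaton A Q)
    (e : LRState Q × A × LRState Q) : Prop :=
  P.kind e.2.1 = LetterKind.intern ∧ (lrSucc 𝒜 e.1.2 e.2.1).Nonempty ∧
  e.2.2 = (lrSuccS 𝒜 e.1.1 e.2.1, lrSucc 𝒜 e.1.2 e.2.1)

/-- Call edges of the left reduction. -/
def lrCallEdge {A Q : Type*} (P : PushdownAlphabet A) (𝒜 : DyckAutomaton A Q)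
    (e : LRState Q × A × LRState Q) : Prop :=
  P.kind e.2.1 = LetterKind.call ∧ (lrSucc 𝒜 e.1.2 e.2.1).Nonempty ∧
  e.2.2 = (lrDiag (lrSucc 𝒜 e.1.2 e.2.1), lrSucc 𝒜 e.1.2 e.2.1)

/-- The `Update` relation associated with a call letter `a`, a return letter `b` and
a summary `S`. -/
def lrUpdate {A Q : Type*} (𝒜 : DyckAutomaton A Q) (a b : A) (S : Set (Q × Q)) :
    Set (Q × Q) :=
  { pp' | ∃ p₁ p₂, (pp'.1, a, p₁) ∈ 𝒜.edges ∧ (p₁, p₂) ∈ S ∧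
      (p₂, b, pp'.2) ∈ 𝒜.edges ∧ ((pp'.1, a, p₁), (p₂, b, pp'.2)) ∈ 𝒜.matched }

/-- Matched pairs of the left reduction: a call edge `e` together with the return
edge `f` constructed from it by the determinization procedure. -/
def lrMatchedPair {A Q : Type*} (P : PushdownAlphabet A) (𝒜 : DyckAutomaton A Q)
    (e f : LRState Q × A × LRState Q) : Prop :=
  lrCallEdge P 𝒜 e ∧ P.kind f.2.1 = LetterKind.ret ∧
  ({ q | ∃ p ∈ e.1.2, (p, q) ∈ lrUpdate 𝒜 e.2.1 f.2.1 f.1.1 } : Set Q).Nonempty ∧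
  f.2.2 = ({ pq | ∃ p', (pq.1, p') ∈ e.1.1 ∧ (p', pq.2) ∈ lrUpdate 𝒜 e.2.1 f.2.1 f.1.1 },
           { q | ∃ p ∈ e.1.2, (p, q) ∈ lrUpdate 𝒜 e.2.1 f.2.1 f.1.1 })

/-- Unmatched return edges of the left reduction, from states with empty summary. -/
def lrRetBotEdge {A Q : Type*} (P : PushdownAlphabet A) (𝒜 : DyckAutomaton A Q)
    (f : LRState Q × A × LRState Q) : Prop :=
  P.kind f.2.1 = LetterKind.ret ∧ f.1.1 = (∅ : Set (Q × Q)) ∧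
  (lrSucc 𝒜 f.1.2 f.2.1).Nonempty ∧
  f.2.2 = ((∅ : Set (Q × Q)), lrSucc 𝒜 f.1.2 f.2.1)

/-- The left reduction before restriction to reachable states. -/
def leftRedFull {A Q : Type*} (P : PushdownAlphabet A) (𝒜 : DyckAutomaton A Q) :
    DyckAutomaton A (LRState Q) where
  edges := { f | lrInternEdge P 𝒜 f ∨ lrCallEdge P 𝒜 f ∨
    (∃ e, lrMatchedPair P 𝒜 e f) ∨ lrRetBotEdge P 𝒜 f }
  matched := { ef | lrMatchedPair P 𝒜 ef.1 ef.2 }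

/-- A state of the left reduction is reachable if some admissible path goes from the
initial state `I` to it. -/
def lrReachable {A Q : Type*} (P : PushdownAlphabet A) (𝒜 : DyckAutomaton A Q)
    (s : LRState Q) : Prop :=
  ∃ π : List (LRState Q × A × LRState Q),
    IsAdmissible P (leftRedFull P 𝒜) π ∧ GoesFromTo π (lrInit Q) s

/-- The left reduction of a Dyck automaton: only the states reachable from the
initial state are kept. -/
def leftReduction {A Q : Type*} (P : PushdownAlphabet A) (𝒜 : DyckAutomaton A Q) :
    DyckAutomaton A (LRState Q) where
  edges := { f ∈ (leftRedFull P 𝒜).edges | lrReachable P 𝒜 f.1 ∧ lrReachable P 𝒜 f.2.2 }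
  matched := { ef ∈ (leftRedFull P 𝒜).matched |
    lrReachable P 𝒜 ef.1.1 ∧ lrReachable P 𝒜 ef.1.2.2 ∧
    lrReachable P 𝒜 ef.2.1 ∧ lrReachable P 𝒜 ef.2.2.2 }

end SD

open SD

namespace SD

section Words

variable {A : Type*} (P : PushdownAlphabet A)

theorem callCount_append (u v : List A) :
    callCount P (u ++ v) = callCount P u + callCount P v := by
  simp [callCount]

theorem retCount_append (u v : List A) :
    retCount P (u ++ v) = retCount P u + retCount P v := by
  simp [retCount]

theorem callCount_cons (a : A) (u : List A) :
    callCount P (a :: u) = callCount P u + if P.kind a = LetterKind.call then 1 else 0 := by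
  simp [callCount, List.countP_cons]

theorem retCount_cons (a : A) (u : List A) :
    retCount P (a :: u) = retCount P u + if P.kind a = LetterKind.ret then 1 else 0 := by
  simp [retCount, List.countP_cons]

theorem IsDyck.callCount_eq {P : PushdownAlphabet A} {u : List A} (h : IsDyck P u) :
    callCount P u = retCount P u :=
  le_antisymm (h.2 [] u rfl) (h.1 u [] (by simp))

theorem matchedCall_nil : MatchedCall P [] := by
  intro v w h
  obtain ⟨-, rfl⟩ := List.append_eq_nil_iff.mp h.symm
  simp [callCount]

/-- A prefix of a matched-call word is matched-call as soon as the remaining suffix does not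
contain more return letters than call letters. -/
theorem MatchedCall.of_append {P : PushdownAlphabet A} {u t : List A}
    (h : MatchedCall P (u ++ t)) (ht : retCount P t ≤ callCount P t) : MatchedCall P u := by
  rintro v w rfl
  have := h v (w ++ t) (by simp)
  rw [callCount_append, retCount_append] at this
  omega

/-- Either a word has no pending call letter, or it factors at its last pending call letter. -/
theorem matchedCall_or_exists_pending (u : List A) :
    MatchedCall P u ∨
      ∃ v a w, u = v ++ a :: w ∧ P.kind a = LetterKind.call ∧ IsDyck P w := by
  induction u with
  | nil => exact Or.inl (matchedCall_nil P)
  | cons a t ih =>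
    rcases ih with ht | ⟨v, b, w, rfl, hb, hw⟩
    · by_cases hle : callCount P (a :: t) ≤ retCount P (a :: t)
      · left
        intro v w h
        cases v with
        | nil =>
          rw [List.nil_append] at h
          exact h ▸ hle
        | cons c v =>
          rw [List.cons_append, List.cons.injEq] at h
          exact ht v w h.2
      · right
        have htt := ht [] t rfl
        rw [callCount_cons, retCount_cons] at hle
        have ha : P.kind a = LetterKind.call := by
          by_contra hne
          rw [if_neg hne] at hle
          omega
        refine ⟨[], a, t, rfl, ha, ?_, ht⟩
        rintro v w rfl
        have hw := ht v w rfl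
        rw [callCount_append, retCount_append] at hle htt
        simp only [ha, if_true, reduceCtorEq, if_false] at hle
        omega
    · exact Or.inr ⟨a :: v, b, w, rfl, hb, hw⟩

end Words

section Paths

variable {A Q : Type*} {P : PushdownAlphabet A} {𝒜 : DyckAutomaton A Q}

theorem pathLabel_append (π ρ : List (Q × A × Q)) :
    pathLabel (π ++ ρ) = pathLabel π ++ pathLabel ρ :=
  List.map_append

theorem pathLabel_cons (e : Q × A × Q) (ρ : List (Q × A × Q)) :
    pathLabel (e :: ρ) = e.2.1 :: pathLabel ρ :=
  rfl

theorem IsAdmissible.of_append {π ρ : List (Q × A × Q)} (h : IsAdmissible P 𝒜 (π ++ ρ)) :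
    IsAdmissible P 𝒜 π := by
  refine ⟨⟨fun e he => h.1.1 e (List.mem_append_left _ he), h.1.2.left_of_append⟩, ?_⟩
  rintro π₀ e π₁ f π₂ rfl
  exact h.2 π₀ e π₁ f (π₂ ++ ρ) (by simp)

theorem StartsAt.of_append {π ρ : List (Q × A × Q)} {p : Q} (h : StartsAt (π ++ ρ) p) :
    StartsAt π p := by
  intro e he
  cases π with
  | nil => simp at he
  | cons g π => exact h e (by simpa using he)

/-- The last state of a path starting at `p`. -/
def endState (p : Q) (π : List (Q × A × Q)) : Q :=
  (π.getLast?.map fun e => e.2.2).getD p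

theorem endState_append_singleton (p : Q) (π : List (Q × A × Q)) (e : Q × A × Q) :
    endState p (π ++ [e]) = e.2.2 := by
  simp [endState]

/-- Each edge of a path starts where the preceding part of the path ends. -/
theorem IsPath.source_eq_endState {π ρ : List (Q × A × Q)} {e : Q × A × Q} {p : Q}
    (h : IsPath 𝒜 (π ++ e :: ρ)) (hs : StartsAt (π ++ e :: ρ) p) : e.1 = endState p π := by
  rcases π.eq_nil_or_concat' with rfl | ⟨π', g, rfl⟩
  · exact hs e (by simp)
  · rw [endState_append_singleton]
    exact (List.isChain_append.mp h.2).2.2 g (by simp) e (by simp) |>.symm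

/-- Either the label of a path has no pending call letter, or the path factors at its last
pending call edge. -/
theorem matchedCall_or_exists_pending_edge (P : PushdownAlphabet A) (π : List (Q × A × Q)) :
    MatchedCall P (pathLabel π) ∨
      ∃ π₀ e π₁, π = π₀ ++ e :: π₁ ∧ P.kind e.2.1 = LetterKind.call ∧
        IsDyck P (pathLabel π₁) := by
  rcases matchedCall_or_exists_pending P (pathLabel π) with h | ⟨v, a, w, h, ha, hw⟩
  · exact Or.inl h
  · obtain ⟨π₀, ρ, rfl, rfl, hρ⟩ := List.map_eq_append_iff.mp h
    obtain ⟨e, π₁, rfl, rfl, rfl⟩ := List.map_eq_cons_iff.mp hρ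
    exact Or.inr ⟨π₀, e, π₁, rfl, ha, hw⟩

end Paths

section LeftReduction

variable {A Q : Type*} {P : PushdownAlphabet A} {𝒜 : DyckAutomaton A Q}

theorem lrInternEdge_of_mem_edges {f : LRState Q × A × LRState Q}
    (hf : f ∈ (leftReduction P 𝒜).edges) (hk : P.kind f.2.1 = LetterKind.intern) :
    lrInternEdge P 𝒜 f := by
  rcases hf.1 with h | h | ⟨e, h⟩ | h
  · exact h
  · simp [h.1] at hk
  · simp [h.2.1] at hk
  · simp [h.1] at hk

theorem lrCallEdge_of_mem_edges {f : LRState Q × A × LRState Q}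
    (hf : f ∈ (leftReduction P 𝒜).edges) (hk : P.kind f.2.1 = LetterKind.call) :
    lrCallEdge P 𝒜 f := by
  rcases hf.1 with h | h | ⟨e, h⟩ | h
  · simp [h.1] at hk
  · exact h
  · simp [h.2.1] at hk
  · simp [h.1] at hk

/-- A return edge leaving a state with empty summary is an unmatched one. -/
theorem lrRetBotEdge_of_mem_edges {f : LRState Q × A × LRState Q}
    (hf : f ∈ (leftReduction P 𝒜).edges) (hk : P.kind f.2.1 = LetterKind.ret)
    (hS : f.1.1 = ∅) : lrRetBotEdge P 𝒜 f := by
  rcases hf.1 with h | h | ⟨e, h⟩ | h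
  · simp [h.1] at hk
  · simp [h.1] at hk
  · obtain ⟨q, p, -, p₁, p₂, -, hp, -⟩ := h.2.2.1
    rw [hS] at hp
    exact hp.elim
  · exact h

/-- An admissible path from the initial state whose label has no pending call letter ends in
a state with empty summary. -/
theorem endState_summary_eq_empty (π : List (LRState Q × A × LRState Q))
    (h : IsAdmissible P (leftReduction P 𝒜) π) (hs : StartsAt π (lrInit Q))
    (hm : MatchedCall P (pathLabel π)) : (endState (lrInit Q) π).1 = ∅ := by
  rcases π.eq_nil_or_concat' with rfl | ⟨ρ, f, rfl⟩
  · rfl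
  rw [endState_append_singleton]
  have hf : f ∈ (leftReduction P 𝒜).edges := h.1.1 f (by simp)
  have hsrc : f.1 = endState (lrInit Q) ρ := h.1.source_eq_endState hs
  rw [pathLabel_append] at hm
  cases hk : P.kind f.2.1 with
  | call =>
    have := hm _ _ rfl
    simp [pathLabel, callCount, retCount, hk] at this
  | intern =>
    have hρ := endState_summary_eq_empty ρ h.of_append hs.of_append
      (hm.of_append (by simp [pathLabel, callCount, retCount, hk]))
    rw [(lrInternEdge_of_mem_edges hf hk).2.2]
    simp [lrSuccS, hsrc, hρ]
  | ret =>
    rcases matchedCall_or_exists_pending_edge P ρ with hρm | ⟨π₀, e, π₁, rfl, he, hd⟩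
    · have hρ := endState_summary_eq_empty ρ h.of_append hs.of_append hρm
      rw [(lrRetBotEdge_of_mem_edges hf hk (hsrc ▸ hρ)).2.2.2]
    · have hef := h.2 π₀ e π₁ f [] (by simp) he hk hd
      rw [List.append_assoc] at h hs
      have hπ₀ : (endState (lrInit Q) π₀).1 = ∅ := by
        refine endState_summary_eq_empty π₀ h.of_append hs.of_append ?_
        rw [pathLabel_append, List.append_assoc] at hm
        refine hm.of_append (le_of_eq ?_)
        have := hd.callCount_eq
        rw [callCount_append, retCount_append, pathLabel_cons, pathLabel_cons]
        simp only [callCount_cons, retCount_cons, he, hk, reduceCtorEq, if_true, if_false]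
        simp [pathLabel, callCount, retCount] at this ⊢
        omega
      have hesrc : e.1 = endState (lrInit Q) π₀ := h.1.source_eq_endState hs
      have hmp : lrMatchedPair P 𝒜 e f := hef.1
      rw [hmp.2.2.2]
      simp [hesrc, hπ₀]
termination_by π.length
decreasing_by all_goals (subst_vars; simp; try omega)

/-- An admissible path from the initial state extends in at most one way by a given letter. -/
theorem last_edge_unique {ρ : List (LRState Q × A × LRState Q)}
    {f g : LRState Q × A × LRState Q}
    (hf : IsAdmissible P (leftReduction P 𝒜) (ρ ++ [f])) (hfs : StartsAt (ρ ++ [f]) (lrInit Q))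
    (hg : IsAdmissible P (leftReduction P 𝒜) (ρ ++ [g])) (hgs : StartsAt (ρ ++ [g]) (lrInit Q))
    (hfg : f.2.1 = g.2.1) : f = g := by
  have hfm : f ∈ (leftReduction P 𝒜).edges := hf.1.1 f (by simp)
  have hgm : g ∈ (leftReduction P 𝒜).edges := hg.1.1 g (by simp)
  have hfsrc : f.1 = endState (lrInit Q) ρ := hf.1.source_eq_endState hfs
  have hgsrc : g.1 = endState (lrInit Q) ρ := hg.1.source_eq_endState hgs
  have hsrc : f.1 = g.1 := hfsrc.trans hgsrc.symm
  refine Prod.ext hsrc (Prod.ext hfg ?_)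
  cases hk : P.kind f.2.1 with
  | call =>
    rw [(lrCallEdge_of_mem_edges hfm hk).2.2, (lrCallEdge_of_mem_edges hgm (hfg ▸ hk)).2.2,
      hsrc, hfg]
  | intern =>
    rw [(lrInternEdge_of_mem_edges hfm hk).2.2, (lrInternEdge_of_mem_edges hgm (hfg ▸ hk)).2.2,
      hsrc, hfg]
  | ret =>
    rcases matchedCall_or_exists_pending_edge P ρ with hm | ⟨π₀, e, π₁, rfl, he, hd⟩
    · have hρ := endState_summary_eq_empty ρ hf.of_append hfs.of_append hm
      rw [(lrRetBotEdge_of_mem_edges hfm hk (hfsrc ▸ hρ)).2.2.2,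
        (lrRetBotEdge_of_mem_edges hgm (hfg ▸ hk) (hgsrc ▸ hρ)).2.2.2, hsrc, hfg]
    · have hef : lrMatchedPair P 𝒜 e f := (hf.2 π₀ e π₁ f [] (by simp) he hk hd).1
      have heg : lrMatchedPair P 𝒜 e g := (hg.2 π₀ e π₁ g [] (by simp) he (hfg ▸ hk) hd).1
      rw [hef.2.2.2, heg.2.2.2, hsrc, hfg]

end LeftReduction

end SD

/-- The left reduction of a Dyck automaton is weak-deterministic: for each word `u`
there is at most one admissible path labeled by `u` starting at the initial state. -/
theorem statement_9 {A : Type*} [Fintype A] (P : PushdownAlphabet A) {N : ℕ}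
    (𝒜 : DyckAutomaton A (Fin N)) (h𝒜 : 𝒜.WellFormed P) :
    ∀ (u : List A) (π₁ π₂ : List (LRState (Fin N) × A × LRState (Fin N))),
      IsAdmissible P (leftReduction P 𝒜) π₁ → StartsAt π₁ (lrInit (Fin N)) →
      pathLabel π₁ = u →
      IsAdmissible P (leftReduction P 𝒜) π₂ → StartsAt π₂ (lrInit (Fin N)) →
      pathLabel π₂ = u →
      π₁ = π₂ := by
  intro u π₁
  induction π₁ using List.reverseRecOn generalizing u with
  | nil =>
    rintro π₂ - - rfl - - h
    exact (List.map_eq_nil_iff.mp h).symm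
  | append_singleton ρ₁ f ih =>
    rintro π₂ hf hfs rfl hg hgs h
    rcases π₂.eq_nil_or_concat' with rfl | ⟨ρ₂, g, rfl⟩
    · simp [pathLabel] at h
    · rw [pathLabel_append, pathLabel_append] at h
      obtain ⟨hρ, hl⟩ := List.append_inj' h rfl
      obtain rfl := ih _ ρ₂ hf.of_append hfs.of_append rfl hg.of_append hgs.of_append hρ
      have hfg : f.2.1 = g.2.1 := (List.cons.inj hl).1.symm
      rw [last_edge_unique hf hfs hg hgs hfg]
end

section
/- The left reduction 𝒟 of a Dyck automaton over a pushdown alphabet A is Dyck(A)-deterministic: for every state (S,R) of 𝒟 and every Dyck word w over A, there is at most one admissible path of 𝒟 labeled by w starting at (S,R). -/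
open SD

theorem SD.callCount_append_s10 {A : Type*} (P : PushdownAlphabet A) (u v : List A) :
    callCount P (u ++ v) = callCount P u + callCount P v :=
  List.countP_append

theorem SD.retCount_append_s10 {A : Type*} (P : PushdownAlphabet A) (u v : List A) :
    retCount P (u ++ v) = retCount P u + retCount P v :=
  List.countP_append

/-- A word with more call letters than return letters has a call letter followed by a
Dyck suffix. -/
theorem SD.exists_call_dyck_suffix {A : Type*} (P : PushdownAlphabet A) (u : List A)
    (h : retCount P u < callCount P u) :
    ∃ u₀ a u₁, u = u₀ ++ a :: u₁ ∧ P.kind a = LetterKind.call ∧ IsDyck P u₁ := by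
  induction hn : u.length using Nat.strong_induction_on generalizing u with
  | _ n ih =>
    cases u with
    | nil => simp [callCount, retCount] at h
    | cons x t =>
      by_cases ht : MatchedCall P t
      · have ht₀ := ht [] t rfl
        have hx : P.kind x = LetterKind.call := by
          by_contra hx
          simp only [callCount, retCount, List.countP_cons, hx] at h ht₀
          simp only [decide_false, Bool.false_eq_true, if_false] at h
          omega
        refine ⟨[], x, t, rfl, hx, ?_, ht⟩
        rintro v w rfl
        have hw := ht v w rfl
        have h' : retCount P (v ++ w) < callCount P (v ++ w) + 1 := by
          simpa [callCount, retCount, List.countP_cons, hx] using h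
        rw [callCount_append_s10, retCount_append_s10] at h'
        omega
      · simp only [MatchedCall, not_forall, not_le] at ht
        obtain ⟨v, w, rfl, hw⟩ := ht
        obtain ⟨u₀, a, u₁, rfl, ha, hu₁⟩ := ih w.length
          (by simp only [List.length_cons, List.length_append] at hn; omega) w hw rfl
        exact ⟨x :: v ++ u₀, a, u₁, by simp, ha, hu₁⟩

theorem SD.IsAdmissible.of_append_s10 {A Q : Type*} {P : PushdownAlphabet A}
    {𝒜 : DyckAutomaton A Q} {π ρ : List (Q × A × Q)} (h : IsAdmissible P 𝒜 (π ++ ρ)) :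
    IsAdmissible P 𝒜 π := by
  refine ⟨⟨fun e he => h.1.1 e (List.mem_append_left _ he), ?_⟩, ?_⟩
  · exact (List.isChain_append.1 h.1.2).1
  · rintro π₀ e π₁ f π₂ rfl he hf hd
    exact h.2 π₀ e π₁ f (π₂ ++ ρ) (by simp) he hf hd

/-- Two edges extending the same path have the same source. -/
theorem SD.source_eq_of_startsAt {A Q : Type*} {𝒜 : DyckAutomaton A Q}
    {π : List (Q × A × Q)} {f g : Q × A × Q} {s : Q}
    (hf : IsPath 𝒜 (π ++ [f])) (hfs : StartsAt (π ++ [f]) s)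
    (hg : IsPath 𝒜 (π ++ [g])) (hgs : StartsAt (π ++ [g]) s) : f.1 = g.1 := by
  rcases π.eq_nil_or_concat with rfl | ⟨π', e, rfl⟩
  · rw [hfs f rfl, hgs g rfl]
  · have h₁ := (List.isChain_append.1 hf.2).2.2 e (by simp) f (by simp)
    have h₂ := (List.isChain_append.1 hg.2).2.2 e (by simp) g (by simp)
    exact h₁.symm.trans h₂

/-- Two edges of the left reduction with the same source and the same label, which is
not a return letter, are equal. -/
theorem SD.leftRedFull_edge_unique {A Q : Type*} {P : PushdownAlphabet A}
    {𝒜 : DyckAutomaton A Q} {f g : LRState Q × A × LRState Q}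
    (hf : f ∈ (leftRedFull P 𝒜).edges) (hg : g ∈ (leftRedFull P 𝒜).edges)
    (hs : f.1 = g.1) (hl : f.2.1 = g.2.1) (hk : P.kind f.2.1 ≠ LetterKind.ret) : f = g := by
  obtain ⟨p, a, q⟩ := f
  obtain ⟨p', a', q'⟩ := g
  obtain rfl : p = p' := hs
  obtain rfl : a = a' := hl
  simp only [leftRedFull, Set.mem_ofPred_eq, lrInternEdge, lrCallEdge, lrMatchedPair,
    lrRetBotEdge] at hf hg hk
  cases hka : P.kind a <;> simp_all

/-- A return edge of the left reduction is determined by its source, its label and the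
call edge it is matched with. -/
theorem SD.lrMatchedPair_unique {A Q : Type*} {P : PushdownAlphabet A}
    {𝒜 : DyckAutomaton A Q} {e f g : LRState Q × A × LRState Q}
    (hf : lrMatchedPair P 𝒜 e f) (hg : lrMatchedPair P 𝒜 e g)
    (hs : f.1 = g.1) (hl : f.2.1 = g.2.1) : f = g := by
  refine Prod.ext hs (Prod.ext hl ?_)
  rw [hf.2.2.2, hg.2.2.2, hs, hl]

/-- The left reduction is deterministic on matched-return words. -/
theorem SD.leftReduction_unique_of_matchedReturn {A Q : Type*} {P : PushdownAlphabet A}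
    {𝒜 : DyckAutomaton A Q} {s : LRState Q} (π₁ : List (LRState Q × A × LRState Q)) :
    ∀ π₂ : List (LRState Q × A × LRState Q), MatchedReturn P (pathLabel π₁) →
      IsAdmissible P (leftReduction P 𝒜) π₁ → StartsAt π₁ s →
      IsAdmissible P (leftReduction P 𝒜) π₂ → StartsAt π₂ s →
      pathLabel π₁ = pathLabel π₂ → π₁ = π₂ := by
  induction π₁ using List.reverseRecOn with
  | nil =>
    intro π₂ _ _ _ _ _ hl
    exact (List.map_eq_nil_iff.1 hl.symm).symm
  | append_singleton ρ f ih =>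
    intro π₂ hw h₁ s₁ h₂ s₂ hl
    rcases π₂.eq_nil_or_concat with rfl | ⟨ρ', g, rfl⟩
    · simp [pathLabel] at hl
    rw [List.concat_eq_append] at h₂ s₂ hl ⊢
    have hl' : pathLabel ρ = pathLabel ρ' ∧ f.2.1 = g.2.1 := by
      simpa only [pathLabel, List.map_append, List.map_singleton, List.append_singleton_inj]
        using hl
    have startsAt_left {ρ : List (LRState Q × A × LRState Q)}
        {f : LRState Q × A × LRState Q} (h : StartsAt (ρ ++ [f]) s) : StartsAt ρ s := by
      cases ρ with
      | nil => simp [StartsAt]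
      | cons e ρ => simpa [StartsAt] using h
    have hw' : MatchedReturn P (pathLabel ρ) := fun v w hvw =>
      hw v (w ++ [f.2.1]) (by simp [pathLabel] at hvw ⊢; simp [hvw])
    obtain rfl := ih ρ' hw' h₁.of_append_s10 (startsAt_left s₁) h₂.of_append_s10
      (startsAt_left s₂) hl'.1
    have hs := source_eq_of_startsAt h₁.1 s₁ h₂.1 s₂
    suffices f = g by rw [this]
    by_cases hk : P.kind f.2.1 = LetterKind.ret
    · have hlt : retCount P (pathLabel ρ) < callCount P (pathLabel ρ) := by
        have := hw (pathLabel ρ ++ [f.2.1]) [] (by simp [pathLabel])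
        rw [retCount_append_s10, callCount_append_s10] at this
        simp [retCount, callCount, hk] at this ⊢
        omega
      obtain ⟨u₀, a, u₁, hu, ha, hd⟩ := exists_call_dyck_suffix P _ hlt
      obtain ⟨σ₀, σ, rfl, -, hσ⟩ := List.map_eq_append_iff.1 hu
      obtain ⟨e, σ₁, rfl, rfl, rfl⟩ := List.map_eq_cons_iff.1 hσ
      exact lrMatchedPair_unique (h₁.2 σ₀ e σ₁ f [] rfl ha hk hd).1
        (h₂.2 σ₀ e σ₁ g [] rfl ha (hl'.2 ▸ hk) hd).1 hs hl'.2
    · exact leftRedFull_edge_unique (h₁.1.1 f (by simp)).1 (h₂.1.1 g (by simp)).1 hs hl'.2 hk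

/-- The left reduction of a Dyck automaton is `Dyck(A)`-deterministic: for every state
of the left reduction and every Dyck word `w` there is at most one admissible path
labeled by `w` starting at this state. -/
theorem statement_10 {A : Type*} [Fintype A] (P : PushdownAlphabet A) {N : ℕ}
    (𝒜 : DyckAutomaton A (Fin N)) (h𝒜 : 𝒜.WellFormed P)
    (s : LRState (Fin N)) (hs : lrReachable P 𝒜 s)
    (w : List A) (hw : IsDyck P w) :
    ∀ π₁ π₂ : List (LRState (Fin N) × A × LRState (Fin N)),
      IsAdmissible P (leftReduction P 𝒜) π₁ → StartsAt π₁ s → pathLabel π₁ = w →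
      IsAdmissible P (leftReduction P 𝒜) π₂ → StartsAt π₂ s → pathLabel π₂ = w →
      π₁ = π₂ := by
  intro π₁ π₂ h₁ s₁ l₁ h₂ s₂ l₂
  exact leftReduction_unique_of_matchedReturn π₁ π₂ (l₁ ▸ hw.1) h₁ s₁ h₂ s₂ (l₁.trans l₂.symm)
end

section
/- Let L be a factorial visibly pushdown language over a pushdown alphabet A. Then the bi-extensible subset E(L) = {w ∈ L : for every n there exist words u, v of length at least n with uwv ∈ L} is a factorial visibly pushdown language over A. -/
namespace SD

/-- A visibly pushdown automaton over `A` with states `Q` and stack alphabet `Γ`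
(with a distinguished bottom-of-stack symbol `bot`). -/
structure VPA (A : Type*) (Q : Type*) (Γ : Type*) where
  init : Set Q
  bot : Γ
  push : Set (Q × A × Q × Γ)
  pop : Set (Q × A × Γ × Q)
  internal : Set (Q × A × Q)
  final : Set Q

/-- `VPA.Steps P V c w c'` : there is a run of the visibly pushdown automaton `V`
labeled by `w` from configuration `c` to configuration `c'`.  A configuration is a
pair of a state and a stack; stacks are represented by the list of their symbols
above the bottom symbol, with the top of the stack at the end of the list. -/
inductive VPA.Steps {A Q Γ : Type*} (P : PushdownAlphabet A) (V : VPA A Q Γ) :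
    Q × List Γ → List A → Q × List Γ → Prop
  | refl (c : Q × List Γ) : VPA.Steps P V c [] c
  | call {p : Q} {σ : List Γ} {a : A} {q : Q} {γ : Γ} {w : List A} {c : Q × List Γ} :
      P.kind a = LetterKind.call → (p, a, q, γ) ∈ V.push → γ ≠ V.bot →
      VPA.Steps P V (q, σ ++ [γ]) w c → VPA.Steps P V (p, σ) (a :: w) c
  | pop {p : Q} {σ : List Γ} {a : A} {γ : Γ} {q : Q} {w : List A} {c : Q × List Γ} :
      P.kind a = LetterKind.ret → (p, a, γ, q) ∈ V.pop → γ ≠ V.bot →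
      VPA.Steps P V (q, σ) w c → VPA.Steps P V (p, σ ++ [γ]) (a :: w) c
  | popBot {p : Q} {a : A} {q : Q} {w : List A} {c : Q × List Γ} :
      P.kind a = LetterKind.ret → (p, a, V.bot, q) ∈ V.pop →
      VPA.Steps P V (q, []) w c → VPA.Steps P V (p, []) (a :: w) c
  | internal {p : Q} {σ : List Γ} {a : A} {q : Q} {w : List A} {c : Q × List Γ} :
      P.kind a = LetterKind.intern → (p, a, q) ∈ V.internal →
      VPA.Steps P V (q, σ) w c → VPA.Steps P V (p, σ) (a :: w) c

/-- A word is accepted by a visibly pushdown automaton if it labels a run from an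
initial state with empty stack to a final state. -/
def VPA.Accepts {A Q Γ : Type*} (P : PushdownAlphabet A) (V : VPA A Q Γ)
    (w : List A) : Prop :=
  ∃ (p q : Q) (σ : List Γ), p ∈ V.init ∧ q ∈ V.final ∧ VPA.Steps P V (p, []) w (q, σ)

/-- A visibly pushdown language over `A`: the set of words accepted by some (finite)
visibly pushdown automaton over `A`. -/
def IsVPL {A : Type*} (P : PushdownAlphabet A) (L : Set (List A)) : Prop :=
  ∃ (nQ nΓ : ℕ) (V : VPA A (Fin nQ) (Fin (nΓ + 1))),
    L = { w | VPA.Accepts P V w }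

/-- A language is factorial if it contains every factor of each of its words. -/
def FactorialLang {A : Type*} (L : Set (List A)) : Prop :=
  ∀ u v w : List A, u ++ v ++ w ∈ L → v ∈ L

/-- A language is extensible if every word of it extends on both sides by nonempty
words to a word of the language. -/
def ExtensibleLang {A : Type*} (L : Set (List A)) : Prop :=
  ∀ u ∈ L, ∃ w z : List A, w ≠ [] ∧ z ≠ [] ∧ w ++ u ++ z ∈ L

/-- The bi-extensible subset of `L`: words of `L` extensible on both sides by
arbitrarily long words within `L`. -/
def BiExt {A : Type*} (L : Set (List A)) : Set (List A) :=
  { w | w ∈ L ∧ ∀ n : ℕ, ∃ u v : List A, n ≤ u.length ∧ n ≤ v.length ∧ u ++ w ++ v ∈ L }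

/-- The set of blocks (finite factors) of a set of bi-infinite sequences. -/
def blocksOf {A : Type*} (X : Set (ℤ → A)) : Set (List A) :=
  { w | ∃ x ∈ X, IsFactorOf w x }

end SD

namespace SD

section Runs

variable {A Q Γ : Type*} {P : PushdownAlphabet A} {V : VPA A Q Γ}

theorem VPA.Steps.append {c c₁ c₂ : Q × List Γ} {u v : List A}
    (h : VPA.Steps P V c u c₁) (h' : VPA.Steps P V c₁ v c₂) :
    VPA.Steps P V c (u ++ v) c₂ := by
  induction h with
  | refl => exact h'
  | call h1 h2 h3 _ ih => exact .call h1 h2 h3 (ih h')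
  | pop h1 h2 h3 _ ih => exact .pop h1 h2 h3 (ih h')
  | popBot h1 h2 _ ih => exact .popBot h1 h2 (ih h')
  | internal h1 h2 _ ih => exact .internal h1 h2 (ih h')

theorem VPA.Steps.exists_of_append {c c₂ : Q × List Γ} {u v : List A}
    (h : VPA.Steps P V c (u ++ v) c₂) :
    ∃ c₁, VPA.Steps P V c u c₁ ∧ VPA.Steps P V c₁ v c₂ := by
  generalize hw : u ++ v = w at h
  induction h generalizing u with
  | refl c =>
    obtain ⟨rfl, rfl⟩ := List.append_eq_nil_iff.1 hw
    exact ⟨c, .refl _, .refl _⟩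
  | call h1 h2 h3 h4 ih =>
    rcases u with - | ⟨b, u⟩
    · obtain rfl : v = _ := hw
      exact ⟨_, .refl _, .call h1 h2 h3 h4⟩
    · obtain ⟨rfl, hw'⟩ := List.cons_eq_cons.1 hw
      obtain ⟨c₁, h5, h6⟩ := ih hw'
      exact ⟨c₁, .call h1 h2 h3 h5, h6⟩
  | pop h1 h2 h3 h4 ih =>
    rcases u with - | ⟨b, u⟩
    · obtain rfl : v = _ := hw
      exact ⟨_, .refl _, .pop h1 h2 h3 h4⟩
    · obtain ⟨rfl, hw'⟩ := List.cons_eq_cons.1 hw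
      obtain ⟨c₁, h5, h6⟩ := ih hw'
      exact ⟨c₁, .pop h1 h2 h3 h5, h6⟩
  | popBot h1 h2 h4 ih =>
    rcases u with - | ⟨b, u⟩
    · obtain rfl : v = _ := hw
      exact ⟨_, .refl _, .popBot h1 h2 h4⟩
    · obtain ⟨rfl, hw'⟩ := List.cons_eq_cons.1 hw
      obtain ⟨c₁, h5, h6⟩ := ih hw'
      exact ⟨c₁, .popBot h1 h2 h5, h6⟩
  | internal h1 h2 h4 ih =>
    rcases u with - | ⟨b, u⟩
    · obtain rfl : v = _ := hw
      exact ⟨_, .refl _, .internal h1 h2 h4⟩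
    · obtain ⟨rfl, hw'⟩ := List.cons_eq_cons.1 hw
      obtain ⟨c₁, h5, h6⟩ := ih hw'
      exact ⟨c₁, .internal h1 h2 h5, h6⟩

theorem VPA.Steps.length_stack_le {c c' : Q × List Γ} {w : List A}
    (h : VPA.Steps P V c w c') : c'.2.length ≤ c.2.length + w.length := by
  induction h <;> simp_all <;> omega

/-- A run from a stack `σ ++ ρ` either never looks below `ρ`, or splits at the moment
when `ρ` has been consumed. -/
theorem VPA.Steps.split_start {c c' : Q × List Γ} {v : List A}
    (h : VPA.Steps P V c v c') {σ ρ : List Γ} (hc : c.2 = σ ++ ρ) :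
    (∃ ρ', c'.2 = σ ++ ρ' ∧ ∀ σ', VPA.Steps P V (c.1, σ' ++ ρ) v (c'.1, σ' ++ ρ')) ∨
    ∃ v₁ v₂ q, v = v₁ ++ v₂ ∧ (∀ σ', VPA.Steps P V (c.1, σ' ++ ρ) v₁ (q, σ')) ∧
      VPA.Steps P V (q, σ) v₂ c' := by
  induction h generalizing ρ with
  | refl c => exact .inl ⟨ρ, hc, fun _ => .refl _⟩
  | @call p s a q γ w c h1 h2 h3 h4 ih =>
    obtain rfl : s = σ ++ ρ := hc
    rcases ih (ρ := ρ ++ [γ]) (by simp) with ⟨ρ', h5, h6⟩ | ⟨v₁, v₂, q', rfl, h6, h7⟩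
    · exact .inl ⟨ρ', h5, fun σ' => .call h1 h2 h3 (by simpa using h6 σ')⟩
    · exact .inr ⟨a :: v₁, v₂, q', rfl, fun σ' => .call h1 h2 h3 (by simpa using h6 σ'), h7⟩
  | @pop p s a γ q w c h1 h2 h3 h4 ih =>
    rcases List.eq_nil_or_concat ρ with rfl | ⟨ρ, g, rfl⟩
    · obtain rfl : σ = s ++ [γ] := by simpa using hc.symm
      exact .inr ⟨[], a :: w, p, rfl, fun σ' => by simpa using .refl _, .pop h1 h2 h3 h4⟩
    · obtain ⟨rfl, rfl⟩ : s = σ ++ ρ ∧ γ = g := by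
        simpa using List.append_inj' (t₂ := [g]) (s₂ := σ ++ ρ) (hc.trans (by simp)) rfl
      rcases ih (ρ := ρ) rfl with ⟨ρ', h5, h6⟩ | ⟨v₁, v₂, q', rfl, h6, h7⟩
      · exact .inl ⟨ρ', h5, fun σ' => by
          simpa using VPA.Steps.pop h1 h2 h3 (h6 σ')⟩
      · exact .inr ⟨a :: v₁, v₂, q', rfl, fun σ' => by
          simpa using VPA.Steps.pop h1 h2 h3 (h6 σ'), h7⟩
  | @popBot p a q w c h1 h2 h4 ih =>
    obtain ⟨rfl, rfl⟩ := List.append_eq_nil_iff.1 hc.symm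
    exact .inr ⟨[], a :: w, p, rfl, fun σ' => by simpa using .refl _, .popBot h1 h2 h4⟩
  | @internal p s a q w c h1 h2 h4 ih =>
    rcases ih hc with ⟨ρ', h5, h6⟩ | ⟨v₁, v₂, q', rfl, h6, h7⟩
    · exact .inl ⟨ρ', h5, fun s => .internal h1 h2 (h6 s)⟩
    · exact .inr ⟨a :: v₁, v₂, q', rfl, fun s => .internal h1 h2 (h6 s), h7⟩

/-- A run to a stack `σ ++ τ` either splits at a configuration with stack `σ` after which
it never looks below, or starts above `σ` and never looks below. -/
theorem VPA.Steps.split_end_aux {c c' : Q × List Γ} {u : List A}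
    (h : VPA.Steps P V c u c') {σ τ : List Γ} (hc : c'.2 = σ ++ τ) :
    (∃ u₁ u₂ q, u = u₁ ++ u₂ ∧ VPA.Steps P V c u₁ (q, σ) ∧
      ∀ σ', VPA.Steps P V (q, σ') u₂ (c'.1, σ' ++ τ)) ∨
    ∃ ρ, c.2 = σ ++ ρ ∧ ∀ σ', VPA.Steps P V (c.1, σ' ++ ρ) u (c'.1, σ' ++ τ) := by
  induction h with
  | refl c => exact .inr ⟨τ, hc, fun _ => .refl _⟩
  | @call p s a q γ w c h1 h2 h3 h4 ih =>
    rcases ih hc with ⟨u₁, u₂, q', rfl, h5, h6⟩ | ⟨ρ, h5, h6⟩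
    · exact .inl ⟨a :: u₁, u₂, q', rfl, .call h1 h2 h3 h5, h6⟩
    · rcases List.eq_nil_or_concat ρ with rfl | ⟨ρ, g, rfl⟩
      · obtain rfl : σ = s ++ [γ] := by simpa using h5.symm
        exact .inl ⟨[a], w, q, rfl, .call h1 h2 h3 (.refl _), fun σ' => by simpa using h6 σ'⟩
      · obtain ⟨rfl, rfl⟩ : s = σ ++ ρ ∧ γ = g := by
          simpa using List.append_inj' (t₂ := [g]) (s₂ := σ ++ ρ) (h5.trans (by simp)) rfl
        exact .inr ⟨ρ, rfl, fun σ' => .call h1 h2 h3 (by simpa using h6 σ')⟩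
  | @pop p s a γ q w c h1 h2 h3 h4 ih =>
    rcases ih hc with ⟨u₁, u₂, q', rfl, h5, h6⟩ | ⟨ρ, h5, h6⟩
    · exact .inl ⟨a :: u₁, u₂, q', rfl, .pop h1 h2 h3 h5, h6⟩
    · obtain rfl : s = σ ++ ρ := h5
      exact .inr ⟨ρ ++ [γ], by simp, fun σ' => by
        simpa using VPA.Steps.pop h1 h2 h3 (h6 σ')⟩
  | @popBot p a q w c h1 h2 h4 ih =>
    rcases ih hc with ⟨u₁, u₂, q', rfl, h5, h6⟩ | ⟨ρ, h5, h6⟩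
    · exact .inl ⟨a :: u₁, u₂, q', rfl, .popBot h1 h2 h5, h6⟩
    · obtain ⟨rfl, rfl⟩ := List.append_eq_nil_iff.1 h5.symm
      exact .inl ⟨[a], w, q, rfl, .popBot h1 h2 (.refl _), fun σ' => by simpa using h6 σ'⟩
  | @internal p s a q w c h1 h2 h4 ih =>
    rcases ih hc with ⟨u₁, u₂, q', rfl, h5, h6⟩ | ⟨ρ, h5, h6⟩
    · exact .inl ⟨a :: u₁, u₂, q', rfl, .internal h1 h2 h5, h6⟩
    · exact .inr ⟨ρ, h5, fun s => .internal h1 h2 (h6 s)⟩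

/-- A run from the empty stack to a stack `σ ++ τ` splits at a configuration with stack `σ`
after which it never looks below. -/
theorem VPA.Steps.split_end {p q : Q} {σ τ : List Γ} {u : List A}
    (h : VPA.Steps P V (p, []) u (q, σ ++ τ)) :
    ∃ u₁ u₂ r, u = u₁ ++ u₂ ∧ VPA.Steps P V (p, []) u₁ (r, σ) ∧
      ∀ σ', VPA.Steps P V (r, σ') u₂ (q, σ' ++ τ) := by
  rcases h.split_end_aux rfl with h | ⟨ρ, h1, h2⟩
  · exact h
  · obtain ⟨rfl, rfl⟩ := List.append_eq_nil_iff.1 h1.symm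
    exact ⟨[], u, p, rfl, .refl _, fun σ' => by simpa using h2 σ'⟩

theorem VPA.Steps.map {Q' Γ' : Type*} {V' : VPA A Q' Γ'} (f : Q → Q') (g : Γ → Γ')
    (hbot : ∀ γ, g γ = V'.bot ↔ γ = V.bot)
    (hpush : ∀ p a q γ, (p, a, q, γ) ∈ V.push → (f p, a, f q, g γ) ∈ V'.push)
    (hpop : ∀ p a γ q, (p, a, γ, q) ∈ V.pop → (f p, a, g γ, f q) ∈ V'.pop)
    (h_internal : ∀ p a q, (p, a, q) ∈ V.internal → (f p, a, f q) ∈ V'.internal)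
    {c c' : Q × List Γ} {w : List A} (h : VPA.Steps P V c w c') :
    VPA.Steps P V' (f c.1, c.2.map g) w (f c'.1, c'.2.map g) := by
  induction h with
  | refl => exact .refl _
  | call h1 h2 h3 _ ih =>
    exact .call h1 (hpush _ _ _ _ h2) (by rwa [Ne, hbot]) (by simpa using ih)
  | pop h1 h2 h3 _ ih =>
    simpa using VPA.Steps.pop h1 (hpop _ _ _ _ h2) (by rwa [Ne, hbot]) ih
  | popBot h1 h2 _ ih =>
    exact .popBot h1 ((hbot V.bot).2 rfl ▸ hpop _ _ _ _ h2) ih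
  | internal h1 h2 _ ih => exact .internal h1 (h_internal _ _ _ h2) ih

end Runs

theorem isVPL_accepts {A Q Γ : Type*} [Finite Q] [Finite Γ] (P : PushdownAlphabet A)
    (V : VPA A Q Γ) : IsVPL P {w | VPA.Accepts P V w} := by
  obtain ⟨nQ, ⟨e⟩⟩ := Finite.exists_equiv_fin Q
  obtain ⟨m, ⟨g⟩⟩ := Finite.exists_equiv_fin Γ
  obtain ⟨k, rfl⟩ : ∃ k, m = k + 1 :=
    Nat.exists_eq_succ_of_ne_zero fun h => (h ▸ g V.bot).elim0
  refine ⟨nQ, k,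
    { init := {p | e.symm p ∈ V.init}
      bot := g V.bot
      push := {x | (e.symm x.1, x.2.1, e.symm x.2.2.1, g.symm x.2.2.2) ∈ V.push}
      pop := {x | (e.symm x.1, x.2.1, g.symm x.2.2.1, e.symm x.2.2.2) ∈ V.pop}
      internal := {x | (e.symm x.1, x.2.1, e.symm x.2.2) ∈ V.internal}
      final := {p | e.symm p ∈ V.final} }, ?_⟩
  ext w
  constructor
  · rintro ⟨p, q, σ, hp, hq, h⟩
    exact ⟨e p, e q, σ.map g, by simpa using hp, by simpa using hq,
      h.map e g (by simp) (by simp) (by simp) (by simp)⟩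
  · rintro ⟨p, q, σ, hp, hq, h⟩
    exact ⟨e.symm p, e.symm q, σ.map g.symm, hp, hq,
      h.map e.symm g.symm (by simp [Equiv.symm_apply_eq]) (by simp) (by simp) (by simp)⟩

instance VPA.finite {A Q Γ : Type*} [Finite A] [Finite Q] [Finite Γ] :
    Finite (VPA A Q Γ) := by
  refine Finite.of_injective (β := Set Q × Γ × Set (Q × A × Q × Γ) × Set (Q × A × Γ × Q) ×
    Set (Q × A × Q) × Set Q)
    (fun V => (V.init, V.bot, V.push, V.pop, V.internal, V.final)) ?_
  rintro ⟨⟩ ⟨⟩ h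
  simpa using h

/-- A sequence of automata over fixed finite state and stack sets takes some value
infinitely often, and this value recognizes the limit of the sequence. -/
theorem isVPL_forall {A Q Γ : Type*} [Finite A] [Finite Q] [Finite Γ]
    (P : PushdownAlphabet A) (N : ℕ → VPA A Q Γ) (S : ℕ → Set (List A)) (hS : Antitone S)
    (hle : ∀ n w, (∀ m, w ∈ S m) → VPA.Accepts P (N n) w)
    (hge : ∀ n w, VPA.Accepts P (N n) w → w ∈ S n) : IsVPL P {w | ∀ n, w ∈ S n} := by
  obtain ⟨V, hV⟩ := Finite.exists_infinite_fiber N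
  have hV := Set.infinite_coe_iff.1 hV
  convert isVPL_accepts P V using 1
  ext w
  constructor
  · intro hw
    obtain ⟨n, rfl⟩ := hV.nonempty
    exact hle n w hw
  · intro hw m
    obtain ⟨n, rfl, hn⟩ := hV.exists_gt m
    exact hS hn.le (hge n w hw)

section RightExtension

variable {A Q Γ : Type*} (P : PushdownAlphabet A) (V : VPA A Q Γ)

/-- Some word of length at least `n` is accepted from the configuration `c`. -/
def VPA.AcceptsLong (n : ℕ) (c : Q × List Γ) : Prop :=
  ∃ v f τ, n ≤ v.length ∧ f ∈ V.final ∧ VPA.Steps P V c v (f, τ)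

/-- The states, with a flag asking for a word of length at least `n`, from which
a stack `σ ++ [γ]` leads to acceptance, given the set `t` of those for `σ`. -/
def VPA.extendType (n : ℕ) (t : Set (Q × Bool)) (γ : Γ) : Set (Q × Bool) :=
  {x | (∃ v f ρ, (if x.2 then n else 0) ≤ v.length ∧ f ∈ V.final ∧
      ∀ σ, VPA.Steps P V (x.1, σ ++ [γ]) v (f, σ ++ ρ)) ∨
    ∃ q b₁ b₂, (x.2 = true → b₁ = true ∨ b₂ = true) ∧
      (∃ v, (if b₁ then n else 0) ≤ v.length ∧
        ∀ σ, VPA.Steps P V (x.1, σ ++ [γ]) v (q, σ)) ∧ (q, b₂) ∈ t}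

/-- The approximate set of states, with a flag asking for a word of length at least `n`,
from which the stack `σ` leads to acceptance. -/
def VPA.stackType (n : ℕ) (σ : List Γ) : Set (Q × Bool) :=
  σ.foldl (VPA.extendType P V n) {x | V.AcceptsLong P (if x.2 then n else 0) (x.1, [])}

variable {P V}

theorem VPA.stackType_concat (n : ℕ) (σ : List Γ) (γ : Γ) :
    V.stackType P n (σ ++ [γ]) = V.extendType P n (V.stackType P n σ) γ := by
  simp [VPA.stackType]

theorem VPA.acceptsLong_of_mem_stackType {n : ℕ} {σ : List Γ} {q : Q} {b : Bool}
    (h : (q, b) ∈ V.stackType P n σ) : V.AcceptsLong P (if b then n else 0) (q, σ) := by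
  induction σ using List.reverseRecOn generalizing q b with
  | nil => exact h
  | append_singleton σ γ ih =>
    rw [VPA.stackType_concat] at h
    rcases h with ⟨v, f, ρ, h1, h2, h3⟩ | ⟨q', b₁, b₂, h1, ⟨v, h2, h3⟩, h4⟩
    · exact ⟨v, f, _, h1, h2, h3 σ⟩
    · obtain ⟨v', f, τ, h5, h6, h7⟩ := ih h4
      refine ⟨v ++ v', f, τ, ?_, h6, (h3 σ).append h7⟩
      rw [List.length_append]
      revert h1 h2 h5
      cases b <;> cases b₁ <;> cases b₂ <;> simp <;> omega

theorem VPA.mem_stackType_of_acceptsLong {n : ℕ} {σ : List Γ} {q : Q} {b : Bool}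
    (h : V.AcceptsLong P (if b then n * (σ.length + 1) else 0) (q, σ)) :
    (q, b) ∈ V.stackType P n σ := by
  induction σ using List.reverseRecOn generalizing q b with
  | nil =>
    change V.AcceptsLong P (if b then n else 0) (q, [])
    simpa using h
  | append_singleton σ γ ih =>
    rw [VPA.stackType_concat]
    obtain ⟨v, f, τ, h1, h2, h3⟩ := h
    have h1 : b = true → n * (σ.length + 1) + n ≤ v.length := by
      rintro rfl
      simpa [mul_add, add_assoc, ← mul_two] using h1
    rcases h3.split_start rfl with ⟨ρ, -, h4⟩ | ⟨v₁, v₂, q', rfl, h4, h5⟩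
    · refine .inl ⟨v, f, ρ, ?_, h2, h4⟩
      cases b <;> simp at h1 ⊢
      omega
    · rw [List.length_append] at h1
      by_cases hb : b = true ∧ v₁.length < n
      · refine .inr ⟨q', false, true, by simp, ⟨v₁, by simp, h4⟩,
          ih ⟨v₂, f, τ, ?_, h2, h5⟩⟩
        have := h1 hb.1
        simp only [if_true]
        omega
      · refine .inr ⟨q', b, false, by simp, ⟨v₁, ?_, h4⟩,
          ih ⟨v₂, f, τ, by simp, h2, h5⟩⟩
        cases b <;> simp at hb ⊢
        omega

variable (P V)

/-- The automaton which runs `V`, keeps track of the type of its stack, and accepts when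
the type says that acceptance is possible after a word of length at least `n`. -/
def VPA.rightExt (n : ℕ) : VPA A (Q × Set (Q × Bool)) (Option (Γ × Set (Q × Bool))) where
  init := {x | x.1 ∈ V.init ∧ x.2 = V.stackType P n []}
  bot := none
  push := {x | ∃ γ, (x.1.1, x.2.1, x.2.2.1.1, γ) ∈ V.push ∧ γ ≠ V.bot ∧
    x.2.2.2 = some (γ, x.1.2) ∧ x.2.2.1.2 = V.extendType P n x.1.2 γ}
  pop := {x | (∃ γ, x.2.2.1 = some (γ, x.2.2.2.2) ∧ γ ≠ V.bot ∧
      (x.1.1, x.2.1, γ, x.2.2.2.1) ∈ V.pop) ∨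
    (x.2.2.1 = none ∧ x.2.2.2.2 = x.1.2 ∧ (x.1.1, x.2.1, V.bot, x.2.2.2.1) ∈ V.pop)}
  internal := {x | (x.1.1, x.2.1, x.2.2.1) ∈ V.internal ∧ x.2.2.2 = x.1.2}
  final := {x | (x.1, true) ∈ x.2}

/-- A stack annotated with the types of its prefixes, starting from the type `t`. -/
def VPA.annotate (n : ℕ) : Set (Q × Bool) → List Γ → List (Option (Γ × Set (Q × Bool)))
  | _, [] => []
  | t, γ :: σ => some (γ, t) :: VPA.annotate n (V.extendType P n t γ) σ

/-- The configuration of `V.rightExt P n` which corresponds to a configuration of `V`. -/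
def VPA.lift (n : ℕ) (c : Q × List Γ) :
    (Q × Set (Q × Bool)) × List (Option (Γ × Set (Q × Bool))) :=
  ((c.1, V.stackType P n c.2), V.annotate P n (V.stackType P n []) c.2)

variable {P V}

theorem VPA.annotate_concat (n : ℕ) (σ : List Γ) (γ : Γ) :
    V.annotate P n (V.stackType P n []) (σ ++ [γ]) =
      V.annotate P n (V.stackType P n []) σ ++ [some (γ, V.stackType P n σ)] := by
  suffices h : ∀ t, V.annotate P n t (σ ++ [γ]) =
      V.annotate P n t σ ++ [some (γ, σ.foldl (V.extendType P n) t)] from h _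
  induction σ with
  | nil => simp [VPA.annotate]
  | cons x σ ih => simp [VPA.annotate, ih]

theorem VPA.Steps.lift (n : ℕ) {c c' : Q × List Γ} {w : List A}
    (h : VPA.Steps P V c w c') :
    VPA.Steps P (V.rightExt P n) (V.lift P n c) w (V.lift P n c') := by
  induction h with
  | refl => exact .refl _
  | @call p s a q γ w c h1 h2 h3 h4 ih =>
    simp only [VPA.lift, VPA.stackType_concat, VPA.annotate_concat] at ih
    exact .call (q := (q, _)) h1 ⟨γ, h2, h3, rfl, rfl⟩ (Option.some_ne_none _) ih
  | @pop p s a γ q w c h1 h2 h3 h4 ih =>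
    simp only [VPA.lift, VPA.annotate_concat]
    exact .pop (q := (q, _)) h1 (.inl ⟨γ, rfl, h3, h2⟩) (Option.some_ne_none _) ih
  | @popBot p a q w c h1 h2 _ ih =>
    exact .popBot (q := (q, _)) h1 (.inr ⟨rfl, rfl, h2⟩) ih
  | @internal p s a q w c h1 h2 _ ih =>
    exact .internal (q := (q, _)) h1 ⟨h2, rfl⟩ ih

theorem VPA.Steps.of_lift (n : ℕ) {c : Q × List Γ} {d d'} {w : List A}
    (h : VPA.Steps P (V.rightExt P n) d w d') (hd : d = V.lift P n c) :
    ∃ c', d' = V.lift P n c' ∧ VPA.Steps P V c w c' := by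
  obtain ⟨q₀, σ⟩ := c
  induction h generalizing q₀ σ with
  | refl => exact ⟨_, hd, .refl _⟩
  | @call p s a q g w d' h1 h2 h3 h4 ih =>
    obtain ⟨q, t⟩ := q
    obtain ⟨rfl, rfl⟩ := Prod.ext_iff.1 hd
    obtain ⟨γ, h5, h6, h7, h8⟩ := h2
    simp only [VPA.lift] at h5 h7 h8
    obtain ⟨c', rfl, h9⟩ := ih q (σ ++ [γ])
      (by simp only [VPA.lift, VPA.stackType_concat, VPA.annotate_concat, h7, h8])
    exact ⟨c', rfl, .call h1 h5 h6 h9⟩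
  | @pop p s a g q w d' h1 h2 h3 h4 ih =>
    obtain ⟨q, t⟩ := q
    obtain ⟨rfl, hs⟩ := Prod.ext_iff.1 hd
    rcases h2 with ⟨γ, h5, h6, h7⟩ | ⟨h5, -⟩
    · simp only [VPA.lift] at h5 h7 hs
      rcases List.eq_nil_or_concat σ with rfl | ⟨σ, g', rfl⟩
      · simp [VPA.annotate] at hs
      · rw [List.concat_eq_append] at hs ⊢
        rw [VPA.annotate_concat, h5] at hs
        obtain ⟨rfl, h8⟩ := List.append_inj' hs rfl
        simp only [List.cons.injEq, Option.some.injEq, Prod.mk.injEq, and_true] at h8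
        obtain ⟨rfl, rfl⟩ := h8
        obtain ⟨c', rfl, h9⟩ := ih q σ rfl
        exact ⟨c', rfl, .pop h1 h7 h6 h9⟩
    · exact (h3 h5).elim
  | @popBot p a q w d' h1 h2 h4 ih =>
    obtain ⟨q, t⟩ := q
    obtain ⟨rfl, hs⟩ := Prod.ext_iff.1 hd
    rcases h2 with ⟨γ, h5, -⟩ | ⟨-, h5, h6⟩
    · cases h5
    · simp only [VPA.lift] at h5 h6 hs
      obtain rfl : σ = [] := by
        rcases σ with - | ⟨g, σ⟩
        · rfl
        · simp [VPA.annotate] at hs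
      obtain ⟨c', rfl, h9⟩ := ih q [] (by rw [h5]; rfl)
      exact ⟨c', rfl, .popBot h1 h6 h9⟩
  | @internal p s a q w d' h1 h2 h4 ih =>
    obtain ⟨q, t⟩ := q
    obtain ⟨rfl, rfl⟩ := Prod.ext_iff.1 hd
    obtain ⟨h5, h6⟩ := h2
    simp only [VPA.lift] at h5 h6
    obtain ⟨c', rfl, h9⟩ := ih q σ (by rw [h6]; rfl)
    exact ⟨c', rfl, .internal h1 h5 h9⟩

/-- Visibly pushdown languages are closed under taking the words which extend to the right
by arbitrarily long words. -/
theorem IsVPL.rightExt [Finite A] {L : Set (List A)} (hL : IsVPL P L) :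
    IsVPL P {w | ∀ n, ∃ v : List A, n ≤ v.length ∧ w ++ v ∈ L} := by
  obtain ⟨nQ, nΓ, V, rfl⟩ := hL
  refine isVPL_forall P (V.rightExt P)
    (fun n => {w | ∃ v : List A, n ≤ v.length ∧ VPA.Accepts P V (w ++ v)}) ?_ ?_ ?_
  · rintro m n hmn w ⟨v, hv, h⟩
    exact ⟨v, hmn.trans hv, h⟩
  · intro n w h
    obtain ⟨v, hv, p, f, τ, hp, hf, h⟩ := h (n * (w.length + 1))
    obtain ⟨⟨q, σ⟩, h1, h2⟩ := h.exists_of_append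
    refine ⟨(p, _), (q, _), _, ⟨hp, rfl⟩, ?_, h1.lift n⟩
    have hlen : σ.length ≤ w.length := by simpa using h1.length_stack_le
    refine VPA.mem_stackType_of_acceptsLong ⟨v, f, τ, ?_, hf, h2⟩
    simp only [if_true]
    exact le_trans (by gcongr) hv
  · rintro n w ⟨⟨p, t⟩, d, s, ⟨hp, ht⟩, hd, h⟩
    simp only at hp ht
    subst ht
    obtain ⟨⟨q, σ⟩, hc, h1⟩ := h.of_lift (c := (p, [])) n rfl
    obtain ⟨rfl, rfl⟩ := Prod.ext_iff.1 hc
    obtain ⟨v, f, τ, hv, hf, h2⟩ := VPA.acceptsLong_of_mem_stackType hd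
    exact ⟨v, by simpa using hv, p, f, τ, hp, hf, h1.append h2⟩

end RightExtension

section LeftExtension

variable {A Q Γ : Type*} (P : PushdownAlphabet A) (V : VPA A Q Γ)

/-- The configuration with state `q` and stack `σ` is reached by some word of length
at least `n`. -/
def VPA.ReachLong (n : ℕ) (q : Q) (σ : List Γ) : Prop :=
  ∃ u p, n ≤ u.length ∧ p ∈ V.init ∧ VPA.Steps P V (p, []) u (q, σ)

/-- Some word of length at least `n` leads from `r` to `q` and pushes `γ` on any stack. -/
def VPA.EdgeLong (n : ℕ) (r : Q) (γ : Γ) (q : Q) : Prop :=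
  ∃ u, n ≤ u.length ∧ ∀ σ, VPA.Steps P V (r, σ) u (q, σ ++ [γ])

/-- The stack `σ` is compatible with a guess: either `none`, the stack is empty, or a state
in which it is reached, with a flag asking for a word of length at least `n`. -/
def VPA.Guess (n : ℕ) (σ : List Γ) : Option (Q × Bool) → Prop
  | none => σ = []
  | some (q, b) => V.ReachLong P (if b then n else 0) q σ

/-- The automaton which runs `V` from an unknown configuration reached by a word of length
at least `n`, guessing the unknown stack as it is popped. -/
def VPA.leftExt (n : ℕ) : VPA A (Q × Option (Q × Bool)) Γ where
  init := {x | x.2 = some (x.1, true)}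
  bot := V.bot
  push := {x | (x.1.1, x.2.1, x.2.2.1.1, x.2.2.2) ∈ V.push ∧ x.2.2.1.2 = x.1.2}
  pop := {x | (x.2.2.1 ≠ V.bot ∧ (x.1.1, x.2.1, x.2.2.1, x.2.2.2.1) ∈ V.pop ∧
      x.2.2.2.2 = x.1.2) ∨
    (x.2.2.1 = V.bot ∧ (x.1.1, x.2.1, V.bot, x.2.2.2.1) ∈ V.pop ∧ x.2.2.2.2 = none ∧
      V.Guess P n [] x.1.2) ∨
    (x.2.2.1 = V.bot ∧ ∃ γ q b r b₁ b₂, γ ≠ V.bot ∧ (x.1.1, x.2.1, γ, x.2.2.2.1) ∈ V.pop ∧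
      x.1.2 = some (q, b) ∧ x.2.2.2.2 = some (r, b₁) ∧ (b = true → b₁ = true ∨ b₂ = true) ∧
      V.EdgeLong P (if b₂ then n else 0) r γ q)}
  internal := {x | (x.1.1, x.2.1, x.2.2.1) ∈ V.internal ∧ x.2.2.2 = x.1.2}
  final := {x | x.1 ∈ V.final ∧ ∃ σ, V.Guess P n σ x.2}

variable {P V}

theorem VPA.exists_steps_of_leftExt {n : ℕ} {c c' : (Q × Option (Q × Bool)) × List Γ}
    {w : List A} (h : VPA.Steps P (V.leftExt P n) c w c') (hc' : c'.1 ∈ (V.leftExt P n).final) :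
    ∃ σ, V.Guess P n σ c.1.2 ∧
      ∃ f ∈ V.final, ∃ τ, VPA.Steps P V (c.1.1, σ ++ c.2) w (f, τ) := by
  induction h with
  | refl c =>
    obtain ⟨h1, σ, h2⟩ := hc'
    exact ⟨σ, h2, _, h1, _, .refl _⟩
  | call h1 h2 h3 h4 ih =>
    obtain ⟨σ, h5, f, hf, τ, h6⟩ := ih hc'
    obtain ⟨h7, h8⟩ := h2
    simp only at h5 h6 h7 h8
    exact ⟨σ, h8 ▸ h5, f, hf, τ, .call h1 h7 h3 (by simpa using h6)⟩
  | pop h1 h2 h3 h4 ih =>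
    obtain ⟨σ, h5, f, hf, τ, h6⟩ := ih hc'
    rcases h2 with ⟨-, h7, h8⟩ | ⟨h7, -⟩ | ⟨h7, -⟩
    · simp only at h5 h6 h7 h8
      exact ⟨σ, h8 ▸ h5, f, hf, τ, by simpa using VPA.Steps.pop h1 h7 h3 h6⟩
    · exact (h3 h7).elim
    · exact (h3 h7).elim
  | @popBot p a q w c h1 h2 h4 ih =>
    obtain ⟨σ, h5, f, hf, τ, h6⟩ := ih hc'
    rcases h2 with ⟨h7, -⟩ | ⟨-, h7, h8, h9⟩ | ⟨-, γ, q', b, r, b₁, b₂, h7, h8, h9, h10, h11, h12⟩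
    · exact (h7 rfl).elim
    · simp only at h5 h6 h7 h8 h9
      rw [h8] at h5
      obtain rfl : σ = [] := h5
      exact ⟨[], h9, f, hf, τ, .popBot h1 h7 h6⟩
    · simp only at h5 h6 h8 h9 h10 ⊢
      rw [h10] at h5
      obtain ⟨u, p', hu, hp', h13⟩ := h5
      obtain ⟨e, he, h14⟩ := h12
      refine ⟨σ ++ [γ], ?_, f, hf, τ, ?_⟩
      · rw [h9]
        refine ⟨u ++ e, p', ?_, hp', h13.append (h14 σ)⟩
        rw [List.length_append]
        revert h11 hu he
        cases b <;> cases b₁ <;> cases b₂ <;> simp <;> omega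
      · simpa using VPA.Steps.pop h1 h8 h7 (by simpa using h6)
  | internal h1 h2 h4 ih =>
    obtain ⟨σ, h5, f, hf, τ, h6⟩ := ih hc'
    obtain ⟨h7, h8⟩ := h2
    simp only at h5 h6 h7 h8
    exact ⟨σ, h8 ▸ h5, f, hf, τ, .internal h1 h7 h6⟩

theorem VPA.Guess.mono {m n : ℕ} (h : m ≤ n) {σ : List Γ} {d : Option (Q × Bool)}
    (hd : V.Guess P n σ d) : V.Guess P m σ d := by
  rcases d with - | ⟨q, b⟩
  · exact hd
  · obtain ⟨u, p, hu, hp, h'⟩ := hd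
    refine ⟨u, p, le_trans ?_ hu, hp, h'⟩
    cases b <;> simp [h]

theorem VPA.exists_leftExt_of_steps {n : ℕ} {c c' : Q × List Γ} {w : List A}
    (h : VPA.Steps P V c w c') (hc' : c'.1 ∈ V.final) {σ ρ : List Γ} (hc : c.2 = σ ++ ρ)
    {d : Option (Q × Bool)} (hd : V.Guess P (n * (w.length + 1)) σ d) :
    ∃ f ∈ (V.leftExt P n).final, ∃ τ,
      VPA.Steps P (V.leftExt P n) ((c.1, d), ρ) w (f, τ) := by
  induction h generalizing σ ρ d with
  | refl c => exact ⟨(c.1, d), ⟨hc', σ, hd.mono (by simp)⟩, _, .refl _⟩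
  | @call p s a q γ w c h1 h2 h3 h4 ih =>
    obtain rfl : s = σ ++ ρ := hc
    obtain ⟨f, hf, τ, h5⟩ := ih hc' (List.append_assoc ..) (hd.mono (by gcongr; simp))
    exact ⟨f, hf, τ, .call (q := (q, d)) h1 ⟨h2, rfl⟩ h3 h5⟩
  | @pop p s a γ q w c h1 h2 h3 h4 ih =>
    rcases List.eq_nil_or_concat ρ with rfl | ⟨ρ, g, rfl⟩
    · obtain rfl : σ = s ++ [γ] := by simpa using hc.symm
      rcases d with - | ⟨q', b⟩
      · simp [VPA.Guess] at hd
      · obtain ⟨u, p', hu, hp', h5⟩ := hd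
        obtain ⟨u₁, u₂, r, rfl, h6, h7⟩ := h5.split_end
        have hu : b = true → n * (w.length + 1) + n ≤ u₁.length + u₂.length := by
          rintro rfl
          simpa [mul_add, add_assoc, ← mul_two] using hu
        obtain ⟨b₁, b₂, hb, hb₁, hb₂⟩ : ∃ b₁ b₂ : Bool, (b = true → b₁ = true ∨ b₂ = true) ∧
            (if b₁ then n * (w.length + 1) else 0) ≤ u₁.length ∧
            (if b₂ then n else 0) ≤ u₂.length := by
          by_cases hb : b = true ∧ u₂.length < n
          · have := hu hb.1
            exact ⟨true, false, by simp, by simp only [if_true]; omega, by simp⟩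
          · refine ⟨false, b, by simp, by simp, ?_⟩
            cases b <;> simp at hb ⊢
            omega
        obtain ⟨f, hf, τ, h8⟩ := ih (σ := s) (ρ := []) (d := some (r, b₁)) hc' (by simp)
          ⟨u₁, p', hb₁, hp', h6⟩
        exact ⟨f, hf, τ, .popBot h1 (.inr (.inr
          ⟨rfl, γ, q', b, r, b₁, b₂, h3, h2, rfl, rfl, hb, u₂, hb₂, h7⟩)) h8⟩
    · obtain ⟨rfl, rfl⟩ : s = σ ++ ρ ∧ γ = g := by
        simpa using List.append_inj' (t₂ := [g]) (s₂ := σ ++ ρ) (hc.trans (by simp)) rfl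
      obtain ⟨f, hf, τ, h5⟩ := ih hc' rfl (hd.mono (by gcongr; simp))
      exact ⟨f, hf, τ, by
        simpa using
          VPA.Steps.pop (p := (p, d)) (q := (q, d)) h1 (V := V.leftExt P n) (.inl ⟨h3, h2, rfl⟩) h3 h5⟩
  | @popBot p a q w c h1 h2 h4 ih =>
    obtain ⟨rfl, rfl⟩ := List.append_eq_nil_iff.1 hc.symm
    obtain ⟨f, hf, τ, h5⟩ := ih (σ := []) (ρ := []) (d := none) hc' rfl rfl
    exact ⟨f, hf, τ, .popBot h1 (.inr (.inl
      ⟨rfl, h2, rfl, hd.mono (Nat.le_mul_of_pos_right _ (by simp))⟩)) h5⟩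
  | @internal p s a q w c h1 h2 h4 ih =>
    obtain ⟨f, hf, τ, h5⟩ := ih hc' hc (hd.mono (by gcongr; simp))
    exact ⟨f, hf, τ, .internal (q := (q, d)) h1 ⟨h2, rfl⟩ h5⟩

/-- Visibly pushdown languages are closed under taking the words which extend to the left
by arbitrarily long words. -/
theorem IsVPL.leftExt [Finite A] {L : Set (List A)} (hL : IsVPL P L) :
    IsVPL P {w | ∀ n, ∃ u : List A, n ≤ u.length ∧ u ++ w ∈ L} := by
  obtain ⟨nQ, nΓ, V, rfl⟩ := hL
  refine isVPL_forall P (V.leftExt P)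
    (fun n => {w | ∃ u : List A, n ≤ u.length ∧ VPA.Accepts P V (u ++ w)}) ?_ ?_ ?_
  · rintro m n hmn w ⟨u, hu, h⟩
    exact ⟨u, hmn.trans hu, h⟩
  · intro n w h
    obtain ⟨u, hu, p, f, τ, hp, hf, h⟩ := h (n * (w.length + 1))
    obtain ⟨⟨q, σ⟩, h1, h2⟩ := h.exists_of_append
    obtain ⟨f', hf', τ', h3⟩ := VPA.exists_leftExt_of_steps (n := n) h2 hf (σ := σ) (ρ := [])
      (by simp) (d := some (q, true)) ⟨u, p, by simpa using hu, hp, h1⟩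
    exact ⟨(q, some (q, true)), f', τ', rfl, hf', h3⟩
  · rintro n w ⟨⟨p, d⟩, f, s, hd, hf, h⟩
    obtain rfl : d = some (p, true) := hd
    obtain ⟨σ, ⟨u, p', hu, hp', h1⟩, f', hf', τ, h2⟩ := VPA.exists_steps_of_leftExt h hf
    exact ⟨u, by simpa using hu, p', f', τ, hp', hf', h1.append (by simpa using h2)⟩

end LeftExtension

theorem FactorialLang.biExt {A : Type*} {L : Set (List A)} (hL : FactorialLang L) :
    FactorialLang (BiExt L) := by
  rintro u v w ⟨h, h'⟩
  refine ⟨hL u v w h, fun n => ?_⟩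
  obtain ⟨x, y, hx, hy, hxy⟩ := h' n
  exact ⟨x ++ u, w ++ y, by simp; omega, by simp; omega, by simpa using hxy⟩

theorem FactorialLang.biExt_eq {A : Type*} [Finite A] {L : Set (List A)}
    (hL : FactorialLang L) :
    BiExt L = {w | ∀ n, ∃ u : List A, n ≤ u.length ∧
      u ++ w ∈ {w | ∀ n, ∃ v : List A, n ≤ v.length ∧ w ++ v ∈ L}} := by
  ext w
  constructor
  · rintro ⟨-, h⟩ n
    have key : ∀ m, ∃ x : {u : List A // u.length = n}, ∃ v : List A,
        m ≤ v.length ∧ x.1 ++ w ++ v ∈ L := by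
      intro m
      obtain ⟨u, v, hu, hv, huv⟩ := h (max m n)
      refine ⟨⟨u.drop (u.length - n), by simp; omega⟩, v, by omega,
        hL (u.take (u.length - n)) _ [] ?_⟩
      simpa [← List.append_assoc] using huv
    choose x v hv hxv using key
    have : Finite {u : List A // u.length = n} := inferInstanceAs (Finite (List.Vector A n))
    obtain ⟨u, hu⟩ := Finite.exists_infinite_fiber x
    have hu := Set.infinite_coe_iff.1 hu
    refine ⟨u.1, u.2.ge, fun m => ?_⟩
    obtain ⟨k, rfl, hk⟩ := hu.exists_gt m
    exact ⟨v k, hk.le.trans (hv k), hxv k⟩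
  · intro h
    have h' : ∀ n, ∃ u v : List A, n ≤ u.length ∧ n ≤ v.length ∧ u ++ w ++ v ∈ L := by
      intro n
      obtain ⟨u, hu, huw⟩ := h n
      obtain ⟨v, hv, huv⟩ := huw n
      exact ⟨u, v, hu, hv, huv⟩
    obtain ⟨u, v, -, -, huv⟩ := h' 0
    exact ⟨hL u w v huv, h'⟩

end SD

open SD

/-- The bi-extensible subset of a factorial visibly pushdown language is a factorial
visibly pushdown language. -/
theorem statement_12 {A : Type*} [Fintype A] (P : PushdownAlphabet A)
    (L : Set (List A)) (hfac : FactorialLang L) (hvpl : IsVPL P L) :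
    FactorialLang (BiExt L) ∧ IsVPL P (BiExt L) := by
  exact ⟨hfac.biExt, hfac.biExt_eq ▸ hvpl.rightExt.leftExt⟩
end
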